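/- Let X be a totally ordered set and F : X^n → X an n-associative, symmetric, nondecreasing, idempotent function. Then F is derived from the binary function G(a,c) = F(a,(n-1)·c): that is, F(x_1,...,x_n) = x_1 ∘ x_2 ∘ ... ∘ x_n where x ∘ y = G(x,y). Moreover F(x_1,...,x_n) = G(min_i x_i, max_i x_i). -/

import Mathlib

/-- `innerApp n F x i` is `F (x i, x (i+1), ..., x (i+n-1))`. -/
def innerApp {X : Type*} (n : ℕ) (F : (Fin n → X) → X) (x : ℕ → X) (i : ℕ) : X :=
  F (fun k => x (i + (k : ℕ)))

/-- `compApp n F x i` is `F (x 0, ..., x (i-1), F (x i, ..., x (i+n-1)), x (i+n), ..., x (2n-2))`,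
i.e. `F` applied to the `(2n-1)`-tuple `x 0, ..., x (2n-2)` with the inner `F` at position `i`. -/
def compApp {X : Type*} (n : ℕ) (F : (Fin n → X) → X) (x : ℕ → X) (i : ℕ) : X :=
  F (fun j => if (j : ℕ) < i then x (j : ℕ)
      else if (j : ℕ) = i then innerApp n F x i
      else x ((j : ℕ) + n - 1))

/-- `F` is `n`-associative. -/
def NAssoc {X : Type*} (n : ℕ) (F : (Fin n → X) → X) : Prop :=
  ∀ (x : ℕ → X) (i : ℕ), i ≤ n - 1 → compApp n F x i = compApp n F x 0

/-- `F` is idempotent. -/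
def Idem {X : Type*} (n : ℕ) (F : (Fin n → X) → X) : Prop :=
  ∀ a : X, F (fun _ => a) = a

/-- `F` is nondecreasing in each variable. -/
def Nondecr {X : Type*} [Preorder X] (n : ℕ) (F : (Fin n → X) → X) : Prop :=
  ∀ x y : Fin n → X, (∀ j, x j ≤ y j) → F x ≤ F y

/-- `F` is monotone: every unary section is order-preserving or order-reversing. -/
def MonoSec {X : Type*} [Preorder X] (n : ℕ) (F : (Fin n → X) → X) : Prop :=
  ∀ (i : Fin n) (a : Fin n → X),
    Monotone (fun t => F (Function.update a i t)) ∨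
      Antitone (fun t => F (Function.update a i t))

/-- `F` is quasitrivial. -/
def Quasitrivial {X : Type*} (n : ℕ) (F : (Fin n → X) → X) : Prop :=
  ∀ x : Fin n → X, ∃ j, F x = x j

/-- `F` is symmetric. -/
def Symm {X : Type*} (n : ℕ) (F : (Fin n → X) → X) : Prop :=
  ∀ (σ : Equiv.Perm (Fin n)) (x : Fin n → X), F (x ∘ σ) = F x

/-- `iterComp G x k = x 0 ∘ x 1 ∘ ... ∘ x k` where `a ∘ b = G a b`. -/
def iterComp {X : Type*} (G : X → X → X) (x : ℕ → X) : ℕ → X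
  | 0 => x 0
  | k+1 => G (iterComp G x k) (x (k+1))

/-- `F` is derived from the binary operation `G`:
`F (x 0, ..., x (n-1)) = x 0 ∘ x 1 ∘ ... ∘ x (n-1)`. -/
def DerivedFrom {X : Type*} (n : ℕ) (F : (Fin n → X) → X) (G : X → X → X) : Prop :=
  ∀ x : ℕ → X, F (fun j => x (j : ℕ)) = iterComp G x (n - 1)

/-- `e` is a neutral element of the `n`-ary operation `F`. -/
def NeutralN {X : Type*} (n : ℕ) (F : (Fin n → X) → X) (e : X) : Prop :=
  ∀ (i : Fin n) (x : X), F (fun j => if j = i then x else e) = x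

/-- Some permutation sends `a` to `i` and `b` to `j`. -/
lemma exists_perm_apply_pair {α : Type*} [DecidableEq α] {a b i j : α} (hab : a ≠ b)
    (hij : i ≠ j) : ∃ σ : Equiv.Perm α, σ a = i ∧ σ b = j := by
  refine ⟨Equiv.swap a i * Equiv.swap b (Equiv.swap a i j), ?_, ?_⟩
  · have h : a ≠ Equiv.swap a i j := fun h => hij <| by
      simpa using congrArg (Equiv.swap a i) h
    rw [Equiv.Perm.mul_apply, Equiv.swap_apply_of_ne_of_ne hab h, Equiv.swap_apply_left]
  · simp

/-- A symmetric `F` does not depend on the position of a single exceptional argument. -/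
lemma Symm.update_const {X : Type*} {n : ℕ} {F : (Fin n → X) → X} (hS : Symm n F)
    (i j : Fin n) (a c : X) :
    F (Function.update (fun _ => c) i a) = F (Function.update (fun _ => c) j a) := by
  rw [← hS (Equiv.swap i j)]
  congr 1
  ext k
  simp only [Function.comp_apply, Function.update_apply, Equiv.swap_apply_eq_iff,
    Equiv.swap_apply_left]

/-- In the presence of an argument `c`, an argument `F (a, c, ..., c)` may be replaced by `a`. -/
lemma NAssoc.update_eq_update {X : Type*} {n : ℕ} {F : (Fin n → X) → X} (hA : NAssoc n F)
    (hS : Symm n F) (hI : Idem n F) {a c f : X} (hn : 2 ≤ n)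
    (hf : f = F (fun j => if (j : ℕ) = 0 then a else c))
    {i j : Fin n} (hij : i ≠ j) (y : Fin n → X) (hy : y j = c) :
    F (Function.update y i f) = F (Function.update y i a) := by
  obtain ⟨σ, hσi, hσj⟩ := exists_perm_apply_pair
    (a := (⟨0, by omega⟩ : Fin n)) (b := ⟨1, by omega⟩) (by simp) hij
  rw [← hS σ (Function.update y i f), ← hS σ (Function.update y i a)]
  have hne : ∀ k : Fin n, (k : ℕ) ≠ 0 → σ k ≠ i := fun k hk e => hk <| by
    rw [← hσi] at e
    simpa using congrArg Fin.val (σ.injective e)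
  obtain ⟨z, z_zero, z_mid, z_tail⟩ : ∃ z : ℕ → X, z 0 = a ∧ (∀ k, k ≠ 0 → k ≤ n → z k = c) ∧
      ∀ k : Fin n, (k : ℕ) ≠ 0 → (k : ℕ) ≠ 1 → z (k + n - 1) = y (σ k) := by
    refine ⟨fun k => if k = 0 then a else if hk : n < k ∧ k < 2 * n - 1 then
      y (σ ⟨k - n + 1, by omega⟩) else c, if_pos rfl, fun k h0 hk => ?_, fun k h0 h1 => ?_⟩
    · beta_reduce
      rw [if_neg h0, dif_neg (by omega)]
    · have := k.2
      beta_reduce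
      rw [if_neg (by omega), dif_pos (by omega)]
      congr 3
      omega
  have inner_zero : innerApp n F z 0 = f := by
    rw [innerApp, hf]
    congr 1
    ext k
    rw [Nat.zero_add]
    split_ifs with h0
    · rw [h0, z_zero]
    · exact z_mid k h0 k.2.le
  have inner_one : innerApp n F z 1 = c :=
    (congrArg F (funext fun k => z_mid _ (by omega) (by omega))).trans (hI c)
  have tail : ∀ k : Fin n, (k : ℕ) ≠ 0 → (k : ℕ) ≠ 1 → ∀ b : X,
      Function.update y i b (σ k) = z (k + n - 1) := fun k h0 h1 b => by
    rw [Function.update_of_ne (hne k h0), z_tail k h0 h1]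
  have one : ∀ k : Fin n, (k : ℕ) = 1 → ∀ b : X, Function.update y i b (σ k) = c := by
    intro k h1 b
    have : k = ⟨1, by omega⟩ := Fin.ext h1
    rw [Function.update_of_ne (hne k (by omega)), this, hσj, hy]
  have zero : ∀ k : Fin n, (k : ℕ) = 0 → ∀ b : X, Function.update y i b (σ k) = b := by
    intro k h0 b
    have : k = ⟨0, by omega⟩ := Fin.ext h0
    rw [this, hσi, Function.update_self]
  have h := hA z 1 (by omega)
  rw [compApp, compApp, inner_zero, inner_one] at h
  refine Eq.trans (congrArg F (funext fun k => ?_)) (h.symm.trans (congrArg F (funext fun k => ?_)))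
  · rw [Function.comp_apply, if_neg (by omega)]
    by_cases h0 : (k : ℕ) = 0
    · rw [if_pos h0, zero k h0]
    · rw [if_neg h0]
      by_cases h1 : (k : ℕ) = 1
      · rw [one k h1, z_mid _ (by omega) (by omega)]
      · exact tail k h0 h1 f
  · rw [Function.comp_apply]
    by_cases h0 : (k : ℕ) = 0
    · rw [if_pos (by omega), zero k h0, h0, z_zero]
    · rw [if_neg (by omega)]
      by_cases h1 : (k : ℕ) = 1
      · rw [if_pos h1, one k h1]
      · rw [if_neg h1]
        exact (tail k h0 h1 a).symm

/-- `F (c, f, ..., f) = F (c, a, ..., a)` for `f = F (a, c, ..., c)`. -/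
lemma NAssoc.update_const_eq {X : Type*} {n : ℕ} {F : (Fin n → X) → X} (hA : NAssoc n F)
    (hS : Symm n F) (hI : Idem n F) {a c f : X} (hn : 2 ≤ n)
    (hf : f = F (fun j => if (j : ℕ) = 0 then a else c)) (i : Fin n) :
    F (Function.update (fun _ => f) i c) = F (Function.update (fun _ => a) i c) := by
  have key : ∀ S : Finset (Fin n), i ∉ S →
      F (fun k => if k = i then c else if k ∈ S then f else a)
        = F (Function.update (fun _ => a) i c) := by
    intro S
    induction S using Finset.induction_on with
    | empty =>
      intro _
      congr 1
      ext k
      simp [Function.update_apply]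
    | insert b S hb ih =>
      intro hi
      rw [Finset.mem_insert, not_or] at hi
      rw [← ih hi.2]
      have h := hA.update_eq_update hS hI hn hf (i := b) (j := i) (Ne.symm hi.1)
        (fun k => if k = i then c else if k ∈ S then f else a) (if_pos rfl)
      convert h using 2
      · ext k
        by_cases hk : k = b
        · subst hk
          simp [Ne.symm hi.1]
        · simp [hk]
      · ext k
        by_cases hk : k = b
        · subst hk
          simp [Ne.symm hi.1, hb]
        · simp [hk]
  rw [← key (Finset.univ.erase i) (by simp)]
  congr 1
  ext k
  by_cases hk : k = i <;> simp [hk]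

/-- Left iterates of a commutative, idempotent, nondecreasing operation that absorbs its right
argument depend only on the least and the greatest term. -/
lemma exists_iterComp_eq {X : Type*} [LinearOrder X] {G : X → X → X}
    (comm : ∀ a b, G a b = G b a) (idem : ∀ a, G a a = a)
    (mono : ∀ a b c d, a ≤ b → c ≤ d → G a c ≤ G b d)
    (absorb : ∀ a b, G (G a b) b = G a b) (x : ℕ → X) (k : ℕ) :
    ∃ i ≤ k, ∃ j ≤ k, (∀ l ≤ k, x i ≤ x l ∧ x l ≤ x j) ∧
      iterComp G x k = G (x i) (x j) := by
  induction k with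
  | zero =>
    refine ⟨0, le_rfl, 0, le_rfl, fun l hl => ?_, (idem _).symm⟩
    rw [Nat.le_zero.1 hl]
    exact ⟨le_rfl, le_rfl⟩
  | succ k ih =>
    obtain ⟨i, hi, j, hj, hx, e⟩ := ih
    have hij : x i ≤ x j := (hx j hj).1
    have absorb' : ∀ a b, G (G a b) a = G a b := fun a b => by rw [comm a b, absorb]
    have split : ∀ {P : ℕ → Prop}, (∀ l ≤ k, P l) → P (k + 1) → ∀ l ≤ k + 1, P l := by
      intro P h h' l hl
      rcases Nat.le_succ_iff.1 hl with hl | rfl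
      exacts [h l hl, h']
    rw [iterComp, e]
    rcases le_total (x (k + 1)) (x i) with h | h
    · refine ⟨k + 1, le_rfl, j, by omega, split (fun l hl => ⟨h.trans (hx l hl).1, (hx l hl).2⟩)
        ⟨le_rfl, h.trans hij⟩, le_antisymm ?_ ?_⟩
      · calc G (G (x i) (x j)) (x (k + 1)) ≤ G (G (x j) (x j)) (x (k + 1)) :=
              mono _ _ _ _ (mono _ _ _ _ hij le_rfl) le_rfl
          _ = G (x (k + 1)) (x j) := by rw [idem, comm]
      · calc G (x (k + 1)) (x j) = G (G (x (k + 1)) (x j)) (x (k + 1)) := (absorb' _ _).symm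
          _ ≤ _ := mono _ _ _ _ (mono _ _ _ _ h le_rfl) le_rfl
    · rcases le_total (x (k + 1)) (x j) with h' | h'
      · refine ⟨i, by omega, j, by omega, split hx ⟨h, h'⟩, le_antisymm ?_ ?_⟩
        · exact (mono _ _ _ _ le_rfl h').trans_eq (absorb _ _)
        · exact (absorb' _ _).symm.trans_le (mono _ _ _ _ le_rfl h)
      · refine ⟨i, by omega, k + 1, le_rfl, split (fun l hl => ⟨(hx l hl).1, (hx l hl).2.trans h'⟩)
          ⟨h, le_rfl⟩, le_antisymm ?_ ?_⟩
        · exact (mono _ _ _ _ (mono _ _ _ _ le_rfl h') le_rfl).trans_eq (absorb _ _)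
        · calc G (x i) (x (k + 1)) = G (G (x i) (x i)) (x (k + 1)) := by rw [idem]
            _ ≤ _ := mono _ _ _ _ (mono _ _ _ _ le_rfl hij) le_rfl

theorem stmt3 {X : Type*} [LinearOrder X] (n : ℕ) (hn : 2 ≤ n)
    (F : (Fin n → X) → X) (hA : NAssoc n F) (hS : Symm n F)
    (hM : Nondecr n F) (hI : Idem n F)
    (G : X → X → X)
    (hG : ∀ a c, G a c = F (fun j => if (j : ℕ) = 0 then a else c)) :
    DerivedFrom n F G ∧
    ∀ x : Fin n → X,
      F x = G (Finset.univ.inf' ⟨⟨0, by omega⟩, Finset.mem_univ _⟩ x)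
              (Finset.univ.sup' ⟨⟨0, by omega⟩, Finset.mem_univ _⟩ x) := by
  have hG' : ∀ (i : Fin n) (a c : X), F (Function.update (fun _ => c) i a) = G a c := by
    intro i a c
    rw [hG, hS.update_const i ⟨0, by omega⟩]
    congr 1
    ext k
    simp [Function.update_apply, Fin.ext_iff]
  let p : Fin n := ⟨0, by omega⟩
  let q : Fin n := ⟨1, by omega⟩
  have hpq : p ≠ q := by simp [p, q]
  have comm_of_le : ∀ a c, a ≤ c → G a c = G c a := by
    intro a c hac
    have hle : G a c ≤ c := by
      rw [hG]
      refine (hM _ (fun _ => c) fun k => ?_).trans_eq (hI c)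
      split_ifs
      exacts [hac, le_rfl]
    refine le_antisymm ?_ ?_
    · rw [← hG' p c a, ← hA.update_const_eq hS hI hn (hG a c) p]
      refine (hI (G a c)).symm.trans_le (hM _ _ fun k => ?_)
      rw [Function.update_apply]
      split_ifs
      exacts [hle, le_rfl]
    · rw [← hG' p c a, ← hG' q a c]
      refine hM _ _ fun k => ?_
      simp only [Function.update_apply]
      by_cases hp : k = p
      · simp [hp, hpq]
      · split_ifs <;> simp [hac]
  have comm : ∀ a b, G a b = G b a := fun a b =>
    (le_total a b).elim (comm_of_le a b) fun h => (comm_of_le b a h).symm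
  have idem : ∀ a, G a a = a := fun a => by
    rw [hG]
    simpa using hI a
  have mono : ∀ a b c d, a ≤ b → c ≤ d → G a c ≤ G b d := by
    intro a b c d hab hcd
    rw [hG, hG]
    refine hM _ _ fun k => ?_
    split_ifs
    exacts [hab, hcd]
  have absorb : ∀ a b, G (G a b) b = G a b := by
    intro a b
    have h := hA.update_eq_update hS hI hn (hG a b) hpq (fun _ => b) rfl
    rwa [hG', hG'] at h
  have sandwich : ∀ (x : Fin n → X) (i j : Fin n), (∀ l, x i ≤ x l ∧ x l ≤ x j) →
      F x = G (x i) (x j) := by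
    intro x i j h
    refine le_antisymm ?_ ?_
    · rw [← hG' i]
      refine hM _ _ fun k => ?_
      by_cases hk : k = i
      · simp [hk]
      · simpa [hk] using (h k).2
    · rw [comm, ← hG' j]
      refine hM _ _ fun k => ?_
      by_cases hk : k = j
      · simp [hk]
      · simpa [hk] using (h k).1
  refine ⟨fun x => ?_, fun x => ?_⟩
  · obtain ⟨i, hi, j, hj, hx, e⟩ := exists_iterComp_eq comm idem mono absorb x (n - 1)
    rw [e]
    exact sandwich (fun l => x l) ⟨i, by omega⟩ ⟨j, by omega⟩ fun l => hx l (by omega)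
  · obtain ⟨i, -, hi⟩ := Finset.exists_mem_eq_inf' ⟨p, Finset.mem_univ p⟩ x
    obtain ⟨j, -, hj⟩ := Finset.exists_mem_eq_sup' ⟨p, Finset.mem_univ p⟩ x
    rw [hi, hj]
    exact sandwich x i j fun l =>
      ⟨hi ▸ Finset.inf'_le x (Finset.mem_univ l), hj ▸ Finset.le_sup' x (Finset.mem_univ l)⟩
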